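/- arXiv:2103.02897 — 3 statements merged into one kernel-verified Lean document; each statement's English description precedes it below -/
import Mathlib

section
/- The power series y(x) = Σ_{n≥1} u_{n,n} x^n, where u_{1,1}=1 and (1-n)u_{n,n} = (1/2) Σ_{k=1}^{n-1}(n-k)u_{k,k}u_{n-k,n-k}, has radius of convergence exactly 2/e. -/
lemma aux_cf (a b : ℕ) : (a + b).choose a * a.factorial * b.factorial = (a + b).factorial := by
  rw [Nat.choose_symm_add]
  exact Nat.add_choose_mul_factorial_mul_factorial a b

open Finset in
lemma aux_diff (m : ℕ) : ∑ k ∈ range (m + 1), ((m + 1).choose (k + 1) : ℝ) * (-1) ^ (m - k) *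
    ((k : ℝ) + 1) ^ m = 0 ^ m := by
  have h := congrFun (fwdDiff_iter_pow_eq_zero_of_lt (R := ℝ) (Nat.lt_succ_self m)) 0
  rw [fwdDiff_iter_eq_sum_shift, Finset.sum_range_succ'] at h
  simp only [Pi.zero_apply, zero_add, nsmul_eq_mul, mul_one, zsmul_eq_mul] at h
  push_cast at h
  simp only [Nat.succ_eq_add_one, Nat.add_sub_add_right, Nat.choose_zero_right, Nat.cast_one,
    mul_one, Nat.sub_zero] at h
  have e : ∑ k ∈ range (m + 1), ((m + 1).choose (k + 1) : ℝ) * (-1) ^ (m - k) *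
    ((k : ℝ) + 1) ^ m = ∑ k ∈ range (m + 1), (-1) ^ (m - k) * ((m + 1).choose (k + 1) : ℝ) *
    ((k : ℝ) + 1) ^ m := Finset.sum_congr rfl fun k _ => by ring
  rw [e]
  rcases Nat.eq_zero_or_pos m with rfl | hm
  · simp
  · rw [zero_pow hm.ne'] at h ⊢
    linarith

lemma aux_choose (n k j : ℕ) (h : k + j ≤ n) :
    (n + 1).choose (k + 1) * (n - k).choose j = (n + 1).choose j * (n - j + 1).choose (k + 1) := by
  obtain ⟨r, rfl⟩ := Nat.exists_eq_add_of_le h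
  have e1 : k + j + r - k = j + r := by omega
  have e2 : k + j + r - j + 1 = (k + 1) + r := by omega
  have e3 : k + j + r + 1 = (k + 1) + (j + r) := by omega
  have e4 : k + j + r + 1 = j + ((k + 1) + r) := by omega
  have a1 := aux_cf (k + 1) (j + r)
  have a2 := aux_cf j r
  have a3 := aux_cf j ((k + 1) + r)
  have a4 := aux_cf (k + 1) r
  rw [← e3] at a1
  rw [← e4] at a3
  rw [e1, e2]
  have p : 0 < (k + 1).factorial * j.factorial * r.factorial := by positivity
  apply Nat.eq_of_mul_eq_mul_right p
  calc _ = (k + j + r + 1).choose (k + 1) * (k + 1).factorial *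
        ((j + r).choose j * j.factorial * r.factorial) := by ring
    _ = (k + j + r + 1).choose j * j.factorial *
        ((k + 1 + r).choose (k + 1) * (k + 1).factorial * r.factorial) := by rw [a2, a1, a4, a3]
    _ = _ := by ring

open Finset in
lemma aux_abel (n : ℕ) : ∑ k ∈ range (n + 1), ((n + 1).choose (k + 1) : ℝ) * ((k : ℝ) + 1) ^ k *
    ((n : ℝ) - k) ^ (n - k) = ((n : ℝ) + 1) ^ (n + 1) := by
  have h1 : ∀ k ∈ range (n + 1), ((n + 1).choose (k + 1) : ℝ) * ((k : ℝ) + 1) ^ k *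
      ((n : ℝ) - k) ^ (n - k) = ∑ j ∈ range (n + 1), (if k + j ≤ n then
        ((n : ℝ) + 1) ^ j * ((n + 1).choose j : ℝ) * (((n - j + 1).choose (k + 1) : ℝ) *
          (-1) ^ (n - j - k) * ((k : ℝ) + 1) ^ (n - j)) else 0) := by
    intro k hk
    rw [Finset.mem_range] at hk
    have e : (n : ℝ) - k = ((n : ℝ) + 1) + (-1) * ((k : ℝ) + 1) := by ring
    rw [e, add_pow ((n : ℝ) + 1), Finset.mul_sum]
    rw [← Finset.sum_subset (Finset.range_mono (by omega : n - k + 1 ≤ n + 1))]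
    · apply Finset.sum_congr rfl
      intro j hj
      rw [Finset.mem_range] at hj
      have hkj : k + j ≤ n := by omega
      rw [if_pos hkj, mul_pow]
      have c : ((n + 1).choose (k + 1) : ℝ) * ((n - k).choose j : ℝ) =
        ((n + 1).choose j : ℝ) * ((n - j + 1).choose (k + 1) : ℝ) := by
        exact_mod_cast aux_choose n k j hkj
      have e1 : n - j = k + (n - k - j) := by omega
      have e2 : n - j - k = n - k - j := by omega
      have e3 : ((k : ℝ) + 1) ^ (n - j) = ((k : ℝ) + 1) ^ k * ((k : ℝ) + 1) ^ (n - k - j) := by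
        rw [← pow_add, ← e1]
      rw [e2, e3]
      linear_combination ((n : ℝ) + 1) ^ j * (-1) ^ (n - k - j) * ((k : ℝ) + 1) ^ k *
        ((k : ℝ) + 1) ^ (n - k - j) * c
    · intro j hj hj'
      rw [Finset.mem_range] at hj hj'
      rw [if_neg (by omega)]
  rw [Finset.sum_congr rfl h1, Finset.sum_comm]
  have h2 : ∀ j ∈ range (n + 1), (∑ k ∈ range (n + 1), (if k + j ≤ n then
        ((n : ℝ) + 1) ^ j * ((n + 1).choose j : ℝ) * (((n - j + 1).choose (k + 1) : ℝ) *
          (-1) ^ (n - j - k) * ((k : ℝ) + 1) ^ (n - j)) else 0)) =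
      ((n : ℝ) + 1) ^ j * ((n + 1).choose j : ℝ) * 0 ^ (n - j) := by
    intro j hj
    rw [Finset.mem_range] at hj
    rw [← aux_diff, Finset.mul_sum]
    rw [← Finset.sum_subset (Finset.range_mono (by omega : n - j + 1 ≤ n + 1))]
    · apply Finset.sum_congr rfl
      intro k hk
      rw [Finset.mem_range] at hk
      rw [if_pos (by omega)]
    · intro k hk hk'
      rw [Finset.mem_range] at hk hk'
      rw [if_neg (by omega)]
  rw [Finset.sum_congr rfl h2, Finset.sum_range_succ, Finset.sum_eq_zero]
  · simp
    ring
  · intro j hj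
    rw [Finset.mem_range] at hj
    rw [zero_pow (by omega), mul_zero]

lemma aux_formula (u : ℕ → ℝ) (h1 : u 1 = 1)
    (hrec : ∀ n : ℕ, 2 ≤ n →
      (1 - (n : ℝ)) * u n =
        (1 / 2) * ∑ k ∈ Finset.Icc 1 (n - 1), ((n : ℝ) - (k : ℝ)) * u k * u (n - k)) (n : ℕ) :
    u (n + 1) = (-1 / 2) ^ n * ((n : ℝ) + 1) ^ n / ((n + 1).factorial : ℝ) := by
  induction n using Nat.strong_induction_on with
  | _ n ih =>
  rcases Nat.eq_zero_or_pos n with rfl | hn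
  · simp [h1]
  have hr := hrec (n + 1) (by omega)
  have e0 : ∑ k ∈ Finset.Icc 1 (n + 1 - 1), (((n + 1 : ℕ) : ℝ) - (k : ℝ)) * u k * u (n + 1 - k) =
      ∑ k ∈ Finset.range n, ((n : ℝ) - k) * u (k + 1) * u (n - k) := by
    have g := Finset.sum_Ico_add'
      (fun k : ℕ => (((n + 1 : ℕ) : ℝ) - (k : ℝ)) * u k * u (n + 1 - k)) 0 n 1
    have g2 : Finset.Icc 1 (n + 1 - 1) = Finset.Ico (0 + 1) (n + 1) := by
      ext i
      simp only [Finset.mem_Icc, Finset.mem_Ico]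
      omega
    rw [g2, ← g, Finset.range_eq_Ico]
    apply Finset.sum_congr rfl
    intro k _
    rw [Nat.add_sub_add_right]
    push_cast
    ring
  have e1 : ∀ k ∈ Finset.range n, ((n : ℝ) - k) * u (k + 1) * u (n - k) =
      (-1 / 2) ^ (n - 1) / ((n + 1).factorial : ℝ) *
      (((n + 1).choose (k + 1) : ℝ) * ((k : ℝ) + 1) ^ k * ((n : ℝ) - k) ^ (n - k)) := by
    intro k hk
    rw [Finset.mem_range] at hk
    obtain ⟨r, rfl⟩ : ∃ r, n = k + r + 1 := ⟨n - k - 1, by omega⟩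
    have f1 : k + r + 1 - k = r + 1 := by omega
    have f2 := aux_cf (k + 1) (r + 1)
    rw [show k + 1 + (r + 1) = k + r + 1 + 1 by ring] at f2
    have f3 : ((k + r + 1 + 1).choose (k + 1) : ℝ) * ((k + 1).factorial : ℝ) *
      ((r + 1).factorial : ℝ) = ((k + r + 1 + 1).factorial : ℝ) := by exact_mod_cast f2
    have p1 : ((k + 1).factorial : ℝ) ≠ 0 := by positivity
    have p2 : ((r + 1).factorial : ℝ) ≠ 0 := by positivity
    have p3 : ((k + r + 1 + 1).choose (k + 1) : ℝ) ≠ 0 := by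
      have := Nat.choose_pos (show k + 1 ≤ k + r + 1 + 1 by omega)
      positivity
    rw [f1, ih k hk, ih r (by omega), ← f3, Nat.add_sub_cancel]
    have f4 : ((k + r + 1 : ℕ) : ℝ) - k = r + 1 := by push_cast; ring
    rw [f4, pow_add (-1 / 2 : ℝ) k r, pow_succ ((r : ℝ) + 1)]
    field_simp
  have ab := aux_abel n
  rw [Finset.sum_range_succ] at ab
  simp only [Nat.choose_self, Nat.cast_one, one_mul, sub_self, Nat.sub_self, pow_zero, mul_one] at ab
  rw [e0, Finset.sum_congr rfl e1, ← Finset.mul_sum, eq_sub_of_add_eq ab] at hr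
  have hn' : (n : ℝ) ≠ 0 := by positivity
  have p : ((n + 1).factorial : ℝ) ≠ 0 := by positivity
  apply mul_left_cancel₀ (neg_ne_zero.mpr hn')
  have q : (-1 / 2 : ℝ) ^ n = (-1 / 2) ^ (n - 1) * (-1 / 2) := by
    rw [← pow_succ, Nat.sub_add_cancel hn]
  push_cast at hr
  rw [q]
  have hr' : -(n : ℝ) * u (n + 1) = (1 - ((n : ℝ) + 1)) * u (n + 1) := by ring
  rw [hr', hr]
  field_simp
  ring

open Filter Topology in
lemma aux_ratio (u : ℕ → ℝ)
    (hu : ∀ n, u (n + 1) = (-1 / 2) ^ n * ((n : ℝ) + 1) ^ n / ((n + 1).factorial : ℝ))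
    (x : ℝ) (hx : x ≠ 0) :
    Tendsto (fun n => ‖u (n + 1) * x ^ (n + 1)‖ / ‖u n * x ^ n‖) atTop
      (𝓝 (Real.exp 1 / 2 * |x|)) := by
  rw [← tendsto_add_atTop_iff_nat 1]
  have t1 := (Real.tendsto_one_add_div_pow_exp 1).comp (tendsto_add_atTop_nat 1)
  have t2 : Tendsto (fun n : ℕ => 1 + 1 / ((n : ℝ) + 1)) atTop (𝓝 (1 + 0)) :=
    tendsto_const_nhds.add tendsto_one_div_add_atTop_nhds_zero_nat
  have t3 := ((t1.div t2 (by norm_num)).div_const 2).mul_const |x|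
  rw [add_zero, div_one] at t3
  refine t3.congr fun n => ?_
  rw [hu, hu]
  simp only [Function.comp, Pi.div_apply, norm_mul, norm_div, norm_pow, Real.norm_eq_abs]
  have hx' : |x| ≠ 0 := abs_ne_zero.mpr hx
  have a1 : |(n : ℝ) + 1| = n + 1 := abs_of_pos (by positivity)
  have a2 : |((n + 1 : ℕ) : ℝ) + 1| = n + 2 := by
    push_cast
    rw [abs_of_pos (by positivity)]; ring
  have a3 : |(-1 : ℝ)| = 1 := by simp
  have a4 : |(2 : ℝ)| = 2 := by simp
  rw [a1, a2, a3, a4, Nat.abs_cast, Nat.abs_cast, Nat.factorial_succ (n + 1)]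
  have p : ((n + 1).factorial : ℝ) ≠ 0 := by positivity
  have e : 1 + 1 / ((n : ℝ) + 1) = (n + 2) / (n + 1) := by field_simp; ring
  push_cast
  rw [e, div_pow, show (n : ℝ) + 1 + 1 = n + 2 by ring]
  have : (n : ℝ) + 2 ≠ 0 := by positivity
  field_simp
  ring

/-- The power series `y(x) = Σ_{n≥1} u_{n,n} x^n`, where `u_{1,1} = 1` and
`(1-n)u_{n,n} = (1/2) Σ_{k=1}^{n-1}(n-k) u_{k,k} u_{n-k,n-k}`, has radius of convergence
exactly `2/e`: it converges (absolutely) for `|x| < 2/e` and diverges for `|x| > 2/e`. -/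
theorem stmt1 (u : ℕ → ℝ) (h0 : u 0 = 0) (h1 : u 1 = 1)
    (hrec : ∀ n : ℕ, 2 ≤ n →
      (1 - (n : ℝ)) * u n =
        (1 / 2) * ∑ k ∈ Finset.Icc 1 (n - 1), ((n : ℝ) - (k : ℝ)) * u k * u (n - k)) :
    (∀ x : ℝ, |x| < 2 / Real.exp 1 → Summable (fun n : ℕ => u n * x ^ n)) ∧
    (∀ x : ℝ, 2 / Real.exp 1 < |x| → ¬ Summable (fun n : ℕ => u n * x ^ n)) := by
  have hu := aux_formula u h1 hrec
  have he := Real.exp_pos 1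
  constructor
  · intro x hx
    rcases eq_or_ne x 0 with rfl | hx0
    · apply summable_of_ne_finset_zero (s := {0})
      intro n hn
      rw [Finset.mem_singleton] at hn
      simp [hn]
    · have hne : ∀ n, u (n + 1) * x ^ (n + 1) ≠ 0 := by
        intro n
        rw [hu]
        have : ((n : ℝ) + 1) ^ n ≠ 0 := by positivity
        have : ((n + 1).factorial : ℝ) ≠ 0 := by positivity
        positivity
      refine summable_of_ratio_test_tendsto_lt_one ?_ ?_ (aux_ratio u hu x hx0)
      · rw [lt_div_iff₀ he] at hx
        linarith
      · filter_upwards [Filter.eventually_ge_atTop 1] with n hn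
        obtain ⟨m, rfl⟩ := Nat.exists_eq_add_of_le' hn
        exact hne m
  · intro x hx
    have hx0 : x ≠ 0 := by
      rintro rfl
      rw [abs_zero] at hx
      have : 0 < 2 / Real.exp 1 := by positivity
      linarith
    refine not_summable_of_ratio_test_tendsto_gt_one ?_ (aux_ratio u hu x hx0)
    rw [div_lt_iff₀ he] at hx
    linarith
end

section
/- Let f(x) = Σ_{n=2}^∞ f_n cos(nx) with Σ_{n=2}^∞ (n-1)^2 f_n^2 < ∞, and define ‖f‖_X^2 = Σ_{n=2}^∞ (n-1)^2 f_n^2. Then ‖f sin x − f' cos x‖_{L^2}^2 ≤ 3 ‖f‖_X^2, where the L^2 norm is normalized so that ‖sin(nx)‖_{L^2} = 1. -/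
open MeasureTheory Filter Topology in
lemma fatou_aux (μ : Measure ℝ) (g : ℕ → ℝ → ℝ) (G : ℝ → ℝ) (hm : ∀ n, Measurable (g n))
    (hlim : ∀ x, Tendsto (fun n => g n x) atTop (𝓝 (G x))) (C : ENNReal)
    (hC : ∀ n, ∫⁻ x, ENNReal.ofReal (g n x ^ 2) ∂μ ≤ C) :
    ∫⁻ x, ENNReal.ofReal (G x ^ 2) ∂μ ≤ C := by
  have h1 : ∀ x, ENNReal.ofReal (G x ^ 2) = liminf (fun n => ENNReal.ofReal (g n x ^ 2)) atTop := by
    intro x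
    exact ((ENNReal.tendsto_ofReal ((hlim x).pow 2)).liminf_eq).symm
  simp_rw [h1]
  refine (lintegral_liminf_le (fun n => ((hm n).pow_const 2).ennreal_ofReal)).trans ?_
  refine (liminf_le_liminf (Eventually.of_forall hC)).trans ?_
  simp

open Real in
lemma int_cos_aux (k : ℤ) (hk : k ≠ 0) : ∫ x in (-π)..π, Real.cos (k * x) = 0 := by
  have hk' : (k : ℝ) ≠ 0 := by exact_mod_cast hk
  rw [intervalIntegral.integral_comp_mul_left (fun x => Real.cos x) hk']
  simp [Real.sin_int_mul_pi]

open Real in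
lemma int_sin_aux (m n : ℕ) :
    ∫ x in (-π)..π, Real.sin (m * x) * Real.sin (n * x) = if m = n ∧ m ≠ 0 then π else 0 := by
  have h : ∀ x : ℝ, Real.sin (m * x) * Real.sin (n * x)
      = (Real.cos (((m - n : ℤ) : ℝ) * x) - Real.cos (((m + n : ℤ) : ℝ) * x)) / 2 := by
    intro x
    push_cast
    rw [sub_mul, add_mul, Real.cos_sub, Real.cos_add]; ring
  simp_rw [h]
  rw [intervalIntegral.integral_div, intervalIntegral.integral_sub
    ((by fun_prop : Continuous _).intervalIntegrable _ _)
    ((by fun_prop : Continuous _).intervalIntegrable _ _)]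
  by_cases hm : m = 0
  · subst hm
    simp
  · rw [int_cos_aux (m + n) (by omega)]
    by_cases hmn : m = n
    · subst hmn
      simp [hm]
    · rw [int_cos_aux (m - n) (by omega)]
      simp [hmn]

open Real in
lemma int_poly_aux (e : ℕ → ℝ) (N : ℕ) :
    ∫ x in (-π)..π, (∑ m ∈ Finset.range N, e m * Real.sin (m * x)) ^ 2
      ≤ π * ∑ m ∈ Finset.range N, e m ^ 2 := by
  have h : ∀ x : ℝ, (∑ m ∈ Finset.range N, e m * Real.sin (m * x)) ^ 2
      = ∑ m ∈ Finset.range N, ∑ n ∈ Finset.range N,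
        (e m * e n) * (Real.sin (m * x) * Real.sin (n * x)) := by
    intro x
    rw [sq, Finset.sum_mul_sum]
    refine Finset.sum_congr rfl fun m _ => Finset.sum_congr rfl fun n _ => by ring
  simp_rw [h]
  rw [intervalIntegral.integral_finsetSum
    (fun m _ => ((by fun_prop : Continuous _).intervalIntegrable _ _)), Finset.mul_sum]
  refine Finset.sum_le_sum fun m hm => ?_
  rw [intervalIntegral.integral_finsetSum
    (fun m _ => ((by fun_prop : Continuous _).intervalIntegrable _ _))]
  simp_rw [intervalIntegral.integral_const_mul, int_sin_aux]
  by_cases h0 : m = 0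
  · subst h0
    simp
    positivity
  · simp only [h0, ne_eq, not_false_eq_true, and_true, mul_ite, mul_zero, Finset.sum_ite_eq, hm,
      if_true]
    apply le_of_eq; ring

open Real MeasureTheory in
lemma lint_poly_aux (e : ℕ → ℝ) (N : ℕ) (C : ℝ) (hC : ∑ m ∈ Finset.range N, e m ^ 2 ≤ C) :
    ∫⁻ x in Set.Ioc (-π) π, ENNReal.ofReal ((∑ m ∈ Finset.range N, e m * Real.sin (m * x)) ^ 2)
      ≤ ENNReal.ofReal (π * C) := by
  have hc : Continuous (fun x : ℝ => (∑ m ∈ Finset.range N, e m * Real.sin (m * x)) ^ 2) := by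
    fun_prop
  rw [← ofReal_integral_eq_lintegral_ofReal]
  · apply ENNReal.ofReal_le_ofReal
    rw [← intervalIntegral.integral_of_le (by linarith [pi_pos])]
    exact (int_poly_aux e N).trans (mul_le_mul_of_nonneg_left hC pi_pos.le)
  · exact (hc.intervalIntegrable (-π) π).1
  · exact Filter.Eventually.of_forall fun x => sq_nonneg _

lemma coef_aux (a : ℕ → ℝ) (ha0 : a 0 = 0) (ha1 : a 1 = 0) (N : ℕ) :
    ∑ m ∈ Finset.range (N + 6), ((m : ℝ) * ((a (m - 1) + a (m + 1)) / 2)) ^ 2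
      ≤ 3 * ∑ n ∈ Finset.range (N + 5), ((n : ℝ) - 1) ^ 2 * a n ^ 2
        + 1 / 2 * (((N : ℝ) + 4) ^ 2 * a (N + 5) ^ 2)
        + 1 / 2 * (((N : ℝ) + 5) ^ 2 * a (N + 6) ^ 2) := by
  induction N with
  | zero =>
    simp [Finset.sum_range_succ, ha0, ha1]
    norm_num
    nlinarith [sq_nonneg (a 2 - 9 * a 4), sq_nonneg (a 3 - a 5), sq_nonneg (a 4 - a 6),
      sq_nonneg (a 3), sq_nonneg (a 4), sq_nonneg (a 5), sq_nonneg (a 6)]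
  | succ N ih =>
    rw [show N + 1 + 6 = (N + 6) + 1 by ring, Finset.sum_range_succ _ (N + 6),
      show N + 1 + 5 = (N + 5) + 1 by ring,
      Finset.sum_range_succ (fun n : ℕ => ((n : ℝ) - 1) ^ 2 * a n ^ 2) (N + 5)]
    have e1 : N + 6 - 1 = N + 5 := by omega
    rw [e1]
    push_cast
    have hN : (0 : ℝ) ≤ N := Nat.cast_nonneg N
    have h1 : (((N : ℝ) + 6) * ((a (N + 5) + a (N + 6 + 1)) / 2)) ^ 2
        ≤ ((N : ℝ) + 6) ^ 2 / 2 * a (N + 5) ^ 2 + ((N : ℝ) + 6) ^ 2 / 2 * a (N + 6 + 1) ^ 2 := by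
      nlinarith [sq_nonneg (((N : ℝ) + 6) * (a (N + 5) - a (N + 6 + 1)))]
    have h2 : ((N : ℝ) + 6) ^ 2 / 2 * a (N + 5) ^ 2 ≤ 5 / 2 * ((N : ℝ) + 4) ^ 2 * a (N + 5) ^ 2 := by
      apply mul_le_mul_of_nonneg_right _ (sq_nonneg _)
      nlinarith
    have e2 : N + 5 + 1 = N + 6 := rfl
    rw [e2]
    have h3 : ((N : ℝ) + 6) ^ 2 / 2 * a (N + 6 + 1) ^ 2
      = 1 / 2 * (((N : ℝ) + 1 + 5) ^ 2 * a (N + 6 + 1) ^ 2) := by ring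
    nlinarith [h1, h2, h3, ih]

lemma coef_bound (a : ℕ → ℝ) (ha0 : a 0 = 0) (ha1 : a 1 = 0)
    (hX : Summable (fun n : ℕ => ((n : ℝ) - 1) ^ 2 * a n ^ 2)) (N : ℕ) :
    ∑ m ∈ Finset.range N, ((m : ℝ) * ((a (m - 1) + a (m + 1)) / 2)) ^ 2
      ≤ 3 * ∑' n : ℕ, ((n : ℝ) - 1) ^ 2 * a n ^ 2 := by
  have h0 : ∑ m ∈ Finset.range N, ((m : ℝ) * ((a (m - 1) + a (m + 1)) / 2)) ^ 2
      ≤ ∑ m ∈ Finset.range (N + 6), ((m : ℝ) * ((a (m - 1) + a (m + 1)) / 2)) ^ 2 :=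
    Finset.sum_le_sum_of_subset_of_nonneg (Finset.range_mono (by omega))
      (fun _ _ _ => sq_nonneg _)
  have h1 := coef_aux a ha0 ha1 N
  have h2 := hX.sum_le_tsum (Finset.range (N + 7)) (fun n _ => by positivity)
  rw [show N + 7 = (N + 5) + 1 + 1 by ring, Finset.sum_range_succ, Finset.sum_range_succ] at h2
  push_cast at h2
  have e1 : N + 5 + 1 = N + 6 := rfl
  rw [e1, show (N : ℝ) + 5 - 1 = N + 4 by ring, show (N : ℝ) + 6 - 1 = N + 5 by ring] at h2
  have p1 : 0 ≤ ((N : ℝ) + 4) ^ 2 * a (N + 5) ^ 2 := by positivity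
  have p2 : 0 ≤ ((N : ℝ) + 5) ^ 2 * a (N + 6) ^ 2 := by positivity
  linarith

lemma hasSum_aux (f : ℝ → ℝ) (a : ℕ → ℝ) (ha0 : a 0 = 0)
    (hf : ∀ x : ℝ, HasSum (fun n : ℕ => a n * Real.cos (n * x)) (f x)) (x : ℝ) :
    HasSum (fun m : ℕ => ((a (m - 1) + a (m + 1)) / 2) * Real.cos (m * x)) (f x * Real.cos x) := by
  have hs : Summable (fun n => |a n|) := by
    have := (hf 0).summable
    simp only [mul_zero, Real.cos_zero, mul_one] at this
    exact this.abs
  have hb : ∀ θ : ℕ → ℝ, Summable (fun n => a n * Real.cos (θ n)) := by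
    intro θ
    refine Summable.of_norm_bounded hs fun n => ?_
    rw [Real.norm_eq_abs, abs_mul]
    exact mul_le_of_le_one_right (abs_nonneg _) (Real.abs_cos_le_one _)
  have h1 := (hb (fun n => ((n : ℝ) + 1) * x)).hasSum
  have h2 := (hb (fun n => ((n : ℝ) - 1) * x)).hasSum
  have h3 := (h1.add h2).div_const 2
  have h4 := (hf x).mul_right (Real.cos x)
  have e : (fun n : ℕ => (a n * Real.cos (((n : ℝ) + 1) * x) + a n * Real.cos (((n : ℝ) - 1) * x)) / 2)
      = fun n : ℕ => a n * Real.cos (n * x) * Real.cos x := by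
    funext n
    rw [add_mul, sub_mul, one_mul, Real.cos_add, Real.cos_sub]; ring
  rw [e] at h3
  rw [h4.unique h3]
  have h1' : HasSum (fun m : ℕ => a (m - 1) * Real.cos (m * x))
      (∑' n : ℕ, a n * Real.cos (((n : ℝ) + 1) * x)) := by
    rw [← hasSum_nat_add_iff' 1]
    simpa [ha0] using h1
  have h2' : HasSum (fun m : ℕ => a (m + 1) * Real.cos (m * x))
      (∑' n : ℕ, a n * Real.cos (((n : ℝ) - 1) * x)) := by
    rw [← hasSum_nat_add_iff' 1] at h2
    simpa [ha0] using h2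
  refine ((h1'.add h2').div_const 2).congr_fun ?_ |> fun h => h
  intro m
  ring

open Real in
/-- Lemma `linear-bound`: if `f(x) = Σ_{n≥2} a n cos(nx)` with
`‖f‖_X² = Σ_{n≥2} (n-1)² (a n)² < ∞`, then `‖f sin x − f' cos x‖_{L²}² ≤ 3 ‖f‖_X²`,
where the `L²` norm is normalized by `‖u‖² = (1/π) ∫_{-π}^{π} u²` (so `‖sin nx‖ = 1`). -/
theorem stmt2 (f f' : ℝ → ℝ) (a : ℕ → ℝ)
    (ha0 : a 0 = 0) (ha1 : a 1 = 0)
    (hX : Summable (fun n : ℕ => ((n : ℝ) - 1) ^ 2 * a n ^ 2))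
    (hf : ∀ x : ℝ, HasSum (fun n : ℕ => a n * Real.cos (n * x)) (f x))
    (hf' : ∀ x : ℝ, HasDerivAt f (f' x) x) :
    (1 / π) * ∫ x in (-π)..π, (f x * Real.sin x - f' x * Real.cos x) ^ 2 ≤
      3 * ∑' n : ℕ, ((n : ℝ) - 1) ^ 2 * a n ^ 2 := by
  set S := ∑' n : ℕ, ((n : ℝ) - 1) ^ 2 * a n ^ 2 with hS
  have hF := hasSum_aux f a ha0 hf
  have hfc : Continuous f := continuous_iff_continuousAt.2 fun x => (hf' x).continuousAt
  have key : ∀ h : ℝ, 0 < h → ∫⁻ x in Set.Ioc (-π) π,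
      ENNReal.ofReal (((f (x + h) * Real.cos (x + h) - f (x - h) * Real.cos (x - h)) / (2 * h)) ^ 2)
      ≤ ENNReal.ofReal (π * (3 * S)) := by
    intro h hh
    refine fatou_aux _ (fun N x => ∑ m ∈ Finset.range N,
      (-((a (m - 1) + a (m + 1)) / 2) * (Real.sin (m * h) / h)) * Real.sin (m * x)) _ ?_ ?_ _ ?_
    · intro N
      exact (by fun_prop : Continuous _).measurable
    · intro x
      apply HasSum.tendsto_sum_nat
      refine (((hF (x + h)).sub (hF (x - h))).div_const (2 * h)).congr_fun ?_
      intro m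
      rw [mul_add, mul_sub, Real.cos_add, Real.cos_sub]
      field_simp
      ring
    · intro N
      refine lint_poly_aux _ N _ (le_trans (Finset.sum_le_sum fun m _ => ?_)
        (coef_bound a ha0 ha1 hX N))
      have hs : (Real.sin (m * h) / h) ^ 2 ≤ (m : ℝ) ^ 2 := by
        apply sq_le_sq.2
        rw [abs_div, abs_of_pos hh, div_le_iff₀ hh]
        refine Real.abs_sin_le_abs.trans (le_of_eq ?_)
        rw [abs_mul, abs_of_pos hh]
      rw [mul_pow, mul_pow, neg_sq, mul_comm]
      exact mul_le_mul_of_nonneg_right hs (sq_nonneg _)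
  have hcont : ∀ h : ℝ, Continuous (fun x : ℝ =>
      (f (x + h) * Real.cos (x + h) - f (x - h) * Real.cos (x - h)) / (2 * h)) := by
    intro h
    fun_prop
  have hlim : ∀ x : ℝ, Filter.Tendsto (fun k : ℕ =>
      (f (x + 1 / ((k : ℝ) + 1)) * Real.cos (x + 1 / ((k : ℝ) + 1))
        - f (x - 1 / ((k : ℝ) + 1)) * Real.cos (x - 1 / ((k : ℝ) + 1))) / (2 * (1 / ((k : ℝ) + 1))))
      Filter.atTop (nhds (f' x * Real.cos x - f x * Real.sin x)) := by
    intro x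
    have hd : HasDerivAt (fun y => f y * Real.cos y) (f' x * Real.cos x + f x * (-Real.sin x)) x :=
      (hf' x).mul (Real.hasDerivAt_cos x)
    have hd1 : HasDerivAt (fun t : ℝ => f (x + t) * Real.cos (x + t)
        - f (x - t) * Real.cos (x - t))
        (2 * (f' x * Real.cos x + f x * (-Real.sin x))) 0 := by
      have ha := HasDerivAt.comp_const_add (f := fun y => f y * Real.cos y) x 0 (by simpa using hd)
      have hb := HasDerivAt.comp_const_sub (f := fun y => f y * Real.cos y) x 0 (by simpa using hd)
      exact (ha.sub hb).congr_deriv (by ring)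
    have ht := hd1.tendsto_slope_zero
    have hseq : Filter.Tendsto (fun k : ℕ => 1 / ((k : ℝ) + 1)) Filter.atTop
        (nhdsWithin 0 {0}ᶜ) := by
      rw [tendsto_nhdsWithin_iff]
      refine ⟨tendsto_one_div_add_atTop_nhds_zero_nat, Filter.Eventually.of_forall fun k => ?_⟩
      have : (0 : ℝ) < 1 / ((k : ℝ) + 1) := by positivity
      exact this.ne'
    have h2 := (ht.comp hseq).div_const 2
    convert h2 using 1
    · funext k
      have : (0 : ℝ) < (k : ℝ) + 1 := by positivity
      simp
      field_simp
    · congr 1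
      ring
  have hmain := fatou_aux (MeasureTheory.volume.restrict (Set.Ioc (-π) π)) _ _
    (fun k : ℕ => (hcont (1 / ((k : ℝ) + 1))).measurable) hlim
    (ENNReal.ofReal (π * (3 * S))) (fun k => key _ (by positivity))
  have hSn : 0 ≤ S := tsum_nonneg fun n => by positivity
  have hmeas : Measurable (fun x => f' x * Real.cos x - f x * Real.sin x) :=
    measurable_of_tendsto_metrizable (fun k : ℕ => (hcont (1 / ((k : ℝ) + 1))).measurable)
      (tendsto_pi_nhds.2 hlim)
  have hle : ∫ x in (-π)..π, (f x * Real.sin x - f' x * Real.cos x) ^ 2 ≤ π * (3 * S) := by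
    have e : ∀ x, (f x * Real.sin x - f' x * Real.cos x) ^ 2
        = (f' x * Real.cos x - f x * Real.sin x) ^ 2 := fun x => by ring
    simp_rw [e]
    rw [intervalIntegral.integral_of_le (by linarith [pi_pos]),
      MeasureTheory.integral_eq_lintegral_of_nonneg_ae
        (Filter.Eventually.of_forall fun x => sq_nonneg _)
        (hmeas.pow_const 2).aestronglyMeasurable]
    exact ENNReal.toReal_le_of_le_ofReal (by positivity) hmain
  have hp := pi_pos
  calc (1 / π) * ∫ x in (-π)..π, (f x * Real.sin x - f' x * Real.cos x) ^ 2
      ≤ (1 / π) * (π * (3 * S)) := mul_le_mul_of_nonneg_left hle (by positivity)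
    _ = 3 * S := by field_simp
end

section
/- Let f = Σ_{n=2}^∞ f_n cos(nx) and g = Σ_{n=2}^∞ g_n cos(nx) with ‖f‖_X^2 = Σ(n−1)^2 f_n^2 and ‖g‖_X^2 = Σ(n−1)^2 g_n^2 finite. Then ‖(fg)'‖_{L^2} ≤ B ‖f‖_X ‖g‖_X, where B = sqrt(π²/3 + 869/144), and the L^2 norm is normalized so that ‖sin(nx)‖_{L^2} = 1. -/
section Helpers
open Real

noncomputable def wgt (m : ℤ) : ℝ := if 2 ≤ |m| then 1 / (|(m : ℝ)| - 1) else 0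
noncomputable def zz (j : ℤ) : ℝ := if 1 ≤ j then 1 / (j : ℝ) ^ 2 else 0

lemma zz_nonneg (j : ℤ) : 0 ≤ zz j := by unfold zz; split_ifs <;> positivity

lemma hasSum_zz : HasSum zz (π ^ 2 / 6) := by
  have h1 : HasSum (fun n : ℕ => zz n) (π ^ 2 / 6) := by
    convert hasSum_zeta_two using 2 with n
    unfold zz
    rcases Nat.eq_zero_or_pos n with h | h
    · subst h; simp
    · rw [if_pos (by exact_mod_cast h)]; simp
  have h2 : HasSum (fun n : ℕ => zz (-n)) 0 := by
    convert hasSum_zero using 2 with n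
    unfold zz
    rw [if_neg (by omega)]
  have := h1.of_nat_of_neg h2
  simpa [zz] using this

lemma hasSum_zz_sub (c : ℤ) : HasSum (fun m => zz (m - c)) (π ^ 2 / 6) := by
  have := (Equiv.subRight c).hasSum_iff (f := zz) (a := π ^ 2 / 6)
  exact this.2 hasSum_zz
lemma hasSum_zz_sub' (c : ℤ) : HasSum (fun m => zz (c - m)) (π ^ 2 / 6) := by
  have := (Equiv.subLeft c).hasSum_iff (f := zz) (a := π ^ 2 / 6)
  exact this.2 hasSum_zz

lemma outer_le (k j β : ℝ) (hk : 0 ≤ k) (hj : 1 ≤ j) (hβ : k ^ 2 ≤ β * (k + 1) ^ 2) :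
    (k * (1 / j) * (1 / (k + j))) ^ 2 ≤ β * (1 / j ^ 2) := by
  have hβ0 : 0 ≤ β := by
    by_contra h
    push Not at h
    have : 0 < (k+1)^2 := by positivity
    nlinarith [sq_nonneg k]
  have : k ^ 2 ≤ β * (k + j) ^ 2 :=
    hβ.trans (mul_le_mul_of_nonneg_left (by gcongr) hβ0)
  have e : (k * (1 / j) * (1 / (k + j))) ^ 2 = k ^ 2 / (k + j) ^ 2 * (1 / j ^ 2) := by
    field_simp
  rw [e]
  gcongr
  rw [div_le_iff₀ (by positivity)]
  exact this

lemma term_le (k : ℤ) (hk : 1 ≤ k) (β : ℝ) (hβ0 : 0 ≤ β)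
    (hβ : (k : ℝ) ^ 2 ≤ β * ((k : ℝ) + 1) ^ 2)
    (E : ℤ → ℝ) (hE0 : ∀ m, 0 ≤ E m)
    (hE : ∀ m : ℤ, 2 ≤ m → m ≤ k - 2 →
      ((k : ℝ) * (1 / ((m : ℝ) - 1)) * (1 / ((k : ℝ) - m - 1))) ^ 2 ≤ E m) (m : ℤ) :
    ((k : ℝ) * wgt m * wgt (k - m)) ^ 2 ≤ E m + β * zz (-1 - m) + β * zz (m - (k + 1)) := by
  have z1 := mul_nonneg hβ0 (zz_nonneg (-1 - m))
  have z2 := mul_nonneg hβ0 (zz_nonneg (m - (k + 1)))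
  have e0 := hE0 m
  have hkR : (1 : ℝ) ≤ k := by exact_mod_cast hk
  by_cases h1 : 2 ≤ |m|
  swap
  · simp [wgt, h1]; linarith
  by_cases h2 : 2 ≤ |k - m|
  swap
  · simp only [wgt, if_neg h2]; simp; linarith
  simp only [wgt, if_pos h1, if_pos h2]
  rcases le_or_gt m (-2) with h | h
  · have hm : (m : ℝ) ≤ -2 := by exact_mod_cast h
    have : zz (-1 - m) = 1 / (-1 - (m : ℝ)) ^ 2 := by
      unfold zz; rw [if_pos (by omega)]; push_cast; rfl
    have o := outer_le k (-1 - m) β (by linarith) (by linarith) hβ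
    rw [abs_of_nonpos (by linarith : (m : ℝ) ≤ 0),
      abs_of_nonneg (by push_cast; linarith : (0 : ℝ) ≤ ((k - m : ℤ) : ℝ))]
    rw [this] at *
    have e : (k : ℝ) * (1 / (-1 - (m : ℝ))) * (1 / ((k : ℝ) + (-1 - m))) =
      (k : ℝ) * (1 / (-(m : ℝ) - 1)) * (1 / (((k - m : ℤ) : ℝ) - 1)) := by
      push_cast
      rw [show -1 - (m : ℝ) = -(m : ℝ) - 1 by ring,
        show (k : ℝ) + (-(m : ℝ) - 1) = (k : ℝ) - m - 1 by ring]
    rw [e] at o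
    linarith
  · have h' : 2 ≤ m := by
      rcases abs_cases m with ⟨a, b⟩ | ⟨a, b⟩ <;> omega
    have hm : (2 : ℝ) ≤ m := by exact_mod_cast h'
    rcases le_or_gt m (k - 2) with g | g
    · have hm2 : (m : ℝ) ≤ k - 2 := by exact_mod_cast g
      rw [abs_of_nonneg (by linarith : (0 : ℝ) ≤ m),
        abs_of_nonneg (by push_cast; linarith : (0 : ℝ) ≤ ((k - m : ℤ) : ℝ))]
      have := hE m h' g
      push_cast
      linarith
    · have g' : k + 2 ≤ m := by
        rcases abs_cases (k - m) with ⟨a, b⟩ | ⟨a, b⟩ <;> omega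
      have hm2 : (k : ℝ) + 2 ≤ m := by exact_mod_cast g'
      have : zz (m - (k + 1)) = 1 / ((m : ℝ) - (k + 1)) ^ 2 := by
        unfold zz; rw [if_pos (by omega)]; push_cast; rfl
      have o := outer_le k (m - (k + 1)) β (by linarith) (by linarith) hβ
      rw [abs_of_nonneg (by linarith : (0 : ℝ) ≤ m),
        abs_of_nonpos (by push_cast; linarith : ((k - m : ℤ) : ℝ) ≤ 0)]
      rw [this] at *
      have e : (k : ℝ) * (1 / ((m : ℝ) - (k + 1))) * (1 / ((k : ℝ) + (m - (k + 1)))) =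
        (k : ℝ) * (1 / ((m : ℝ) - 1)) * (1 / (-((k - m : ℤ) : ℝ) - 1)) := by
        push_cast
        rw [mul_right_comm, show (k : ℝ) + ((m : ℝ) - (k + 1)) = (m : ℝ) - 1 by ring,
          show (m : ℝ) - (k + 1) = -((k : ℝ) - m) - 1 by ring]
      rw [e] at o
      linarith

lemma sum_bound (k : ℤ) (hk : 1 ≤ k) (β : ℝ) (hβ0 : 0 ≤ β)
    (hβ : (k : ℝ) ^ 2 ≤ β * ((k : ℝ) + 1) ^ 2)
    (E : ℤ → ℝ) (S : ℝ) (hES : HasSum E S) (hE0 : ∀ m, 0 ≤ E m)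
    (hE : ∀ m : ℤ, 2 ≤ m → m ≤ k - 2 →
      ((k : ℝ) * (1 / ((m : ℝ) - 1)) * (1 / ((k : ℝ) - m - 1))) ^ 2 ≤ E m)
    (hS : S + β * (π ^ 2 / 6) + β * (π ^ 2 / 6) ≤ 2 * (π ^ 2 / 3 + 869 / 144)) (s : Finset ℤ) :
    ∑ m ∈ s, ((k : ℝ) * wgt m * wgt (k - m)) ^ 2 ≤ 2 * (π ^ 2 / 3 + 869 / 144) := by
  refine le_trans (Finset.sum_le_sum fun m _ => term_le k hk β hβ0 hβ E hE0 hE m) ?_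
  refine le_trans ?_ hS
  refine sum_le_hasSum s (fun m _ => ?_)
    ((hES.add ((hasSum_zz_sub' (-1)).mul_left β)).add ((hasSum_zz_sub (k + 1)).mul_left β))
  have z1 := mul_nonneg hβ0 (zz_nonneg (-1 - m))
  have z2 := mul_nonneg hβ0 (zz_nonneg (m - (k + 1)))
  have := hE0 m
  positivity

lemma C_pos (k : ℤ) (hk : 1 ≤ k) (s : Finset ℤ) :
    ∑ m ∈ s, ((k : ℝ) * wgt m * wgt (k - m)) ^ 2 ≤ 2 * (π ^ 2 / 3 + 869 / 144) := by
  have p1 := Real.pi_gt_d2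
  have p2 := Real.pi_lt_d2
  have hkR : (1 : ℝ) ≤ k := by exact_mod_cast hk
  have q1 : 3.14 ^ 2 < π ^ 2 := by gcongr
  have q2 : π ^ 2 < 3.15 ^ 2 := by gcongr
  rcases (by omega : k ≤ 3 ∨ k = 4 ∨ k = 5 ∨ 6 ≤ k) with h | h | h | h
  · refine sum_bound k hk 1 (by norm_num) (by nlinarith) (fun _ => 0) 0 hasSum_zero
      (fun _ => le_rfl) (fun m h1 h2 => by omega) (by linarith) s
  · subst h
    refine sum_bound 4 hk (16 / 25) (by norm_num) (by norm_num) (fun m => if m = 2 then 16 else 0) 16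
      (hasSum_ite_eq 2 16)
      (fun m => by split_ifs <;> norm_num) (fun m h1 h2 => ?_) (by norm_num at *; linarith) s
    obtain rfl : m = 2 := by omega
    norm_num
  · subst h
    refine sum_bound 5 hk 1 (by norm_num) (by norm_num)
      (fun m => (if m = 2 then 25 / 4 else 0) + (if m = 3 then 25 / 4 else 0)) (25 / 4 + 25 / 4)
      ((hasSum_ite_eq 2 (25 / 4)).add (hasSum_ite_eq 3 (25 / 4)))
      (fun m => by split_ifs <;> norm_num) (fun m h1 h2 => ?_) (by norm_num at *; linarith) s
    obtain rfl | rfl : m = 2 ∨ m = 3 := by omega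
    · norm_num
    · norm_num
  · have h6 : (6 : ℝ) ≤ k := by exact_mod_cast h
    refine sum_bound k hk 1 (by norm_num) (by nlinarith)
      (fun m => 9 / 2 * zz (m - 1) + 9 / 2 * zz (k - 1 - m)) _
      (((hasSum_zz_sub 1).mul_left (9 / 2)).add ((hasSum_zz_sub' (k - 1)).mul_left (9 / 2)))
      (fun m => by have := zz_nonneg (m - 1); have := zz_nonneg (k - 1 - m); positivity)
      (fun m h1 h2 => ?_) (by norm_num at *; linarith) s
    have r1 : (2 : ℝ) ≤ m := by exact_mod_cast h1
    have r2 : (m : ℝ) ≤ k - 2 := by exact_mod_cast h2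
    simp only [zz]
    rw [if_pos (by omega), if_pos (by omega)]
    push_cast
    have y1 : 0 < (m : ℝ) - 1 := by linarith
    have y2 : 0 < (k : ℝ) - 1 - m := by linarith
    generalize hx : (m : ℝ) - 1 = x at *
    generalize hy : (k : ℝ) - 1 - m = y at *
    have : (k : ℝ) - m - 1 = y := by linarith
    rw [this]
    have kk : (k : ℝ) ≤ 3 / 2 * (x + y) := by linarith
    have : (k : ℝ) * (1 / x) * (1 / y) ≤ 3 / 2 * (1 / x + 1 / y) := by
      have : 3 / 2 * (1 / x + 1 / y) = (3 / 2 * (x + y)) * (1 / x) * (1 / y) := by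
        field_simp; ring
      rw [this]; gcongr
    have := pow_le_pow_left₀ (by positivity) this 2
    rw [← one_div_pow, ← one_div_pow]
    nlinarith [sq_nonneg (1 / x - 1 / y)]

lemma C_all (k : ℤ) (s : Finset ℤ) :
    ∑ m ∈ s, ((k : ℝ) * wgt m * wgt (k - m)) ^ 2 ≤ 2 * (π ^ 2 / 3 + 869 / 144) := by
  rcases lt_trichotomy k 0 with h | h | h
  · have := C_pos (-k) (by omega) (s.map (Equiv.neg ℤ).toEmbedding)
    rw [Finset.sum_map] at this
    refine le_trans (le_of_eq ?_) this
    refine Finset.sum_congr rfl fun m _ => ?_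
    have w1 : ∀ m, wgt (-m) = wgt m := fun m => by simp [wgt]
    have e : -k - -m = -(k - m) := by ring
    simp only [Equiv.coe_toEmbedding, Equiv.neg_apply, e, w1]
    push_cast
    ring
  · subst h; simp; positivity
  · exact C_pos k h s

lemma cauchy (c d : ℤ → ℝ) (K D : ℝ) (h : Summable fun m => c m * d m)
    (hc : ∀ s : Finset ℤ, ∑ m ∈ s, c m ^ 2 ≤ K) (hd : HasSum (fun m => d m ^ 2) D) :
    (∑' m, c m * d m) ^ 2 ≤ K * D := by
  refine le_of_tendsto' (h.hasSum.pow 2) fun s => ?_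
  refine (Finset.sum_mul_sq_le_sq_mul_sq s c d).trans ?_
  have := sum_le_hasSum s (fun m _ => sq_nonneg (d m)) hd
  have h0 : 0 ≤ K := by simpa using hc ∅
  exact mul_le_mul (hc s) this (Finset.sum_nonneg fun _ _ => sq_nonneg _) h0

lemma hasSum_congr_aux {E : Type*} [AddCommMonoid E] [TopologicalSpace E] {u v : ℤ → E} {S : E}
    (h : ∀ k, u k = v k) : HasSum u S ↔ HasSum v S := by
  rw [funext h]

lemma coeff_series (H : ℤ → ℂ) (hH : Summable fun k => ‖H k‖) (h : ℝ → ℂ)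
    (hh : ∀ x : ℝ, HasSum (fun k : ℤ => H k * Complex.exp (k * x * Complex.I)) (h x)) (n : ℤ) :
    fourierCoeffOn (neg_lt_self pi_pos) h n = H n := by
  rw [fourierCoeffOn_eq_integral]
  have e1 : ∀ (x : ℝ) (n : ℤ), fourier n (x : AddCircle (π - -π)) = Complex.exp (n * x * Complex.I) := by
    intro x n
    rw [fourier_coe_apply]
    congr 1
    have : (π : ℂ) ≠ 0 := by exact_mod_cast pi_ne_zero
    push_cast
    field_simp
    ring
  simp only [e1, smul_eq_mul]
  have key : HasSum (fun k : ℤ => ∫ x in (-π)..π, H k * Complex.exp (((k - n : ℤ) : ℂ) * x * Complex.I))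
      (∫ x in (-π)..π, Complex.exp (((-n : ℤ) : ℂ) * x * Complex.I) * h x) := by
    refine intervalIntegral.hasSum_integral_of_dominated_convergence (fun k _ => ‖H k‖) ?_ ?_ ?_ ?_ ?_
    · intro k
      apply Continuous.aestronglyMeasurable
      fun_prop
    · intro k
      refine Filter.Eventually.of_forall fun x _ => ?_
      rw [norm_mul]
      have : ‖Complex.exp (((k - n : ℤ) : ℂ) * x * Complex.I)‖ = 1 := by
        rw [show (((k - n : ℤ) : ℂ) * x * Complex.I) = (((k - n : ℤ) * x : ℝ) : ℂ) * Complex.I by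
          push_cast; ring]
        exact Complex.norm_exp_ofReal_mul_I _
      rw [this, mul_one]
    · exact Filter.Eventually.of_forall fun x _ => hH
    · exact intervalIntegrable_const
    · refine Filter.Eventually.of_forall fun x _ => ?_
      have hx := (hh x).mul_left (Complex.exp (((-n : ℤ) : ℂ) * x * Complex.I))
      refine (hasSum_congr_aux fun k => ?_).2 hx
      rw [show (((k - n : ℤ) : ℂ) * x * Complex.I) = ((-n : ℤ) : ℂ) * x * Complex.I + k * x * Complex.I by
          push_cast; ring, Complex.exp_add]
      ring
  have key2 : HasSum (fun k : ℤ => ∫ x in (-π)..π, H k * Complex.exp (((k - n : ℤ) : ℂ) * x * Complex.I))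
      (2 * π * H n) := by
    convert hasSum_ite_eq n (2 * π * H n) using 2 with k
    rw [intervalIntegral.integral_const_mul]
    split_ifs with hk
    · subst hk
      simp
      ring
    · have hc : ((k - n : ℤ) : ℂ) * Complex.I ≠ 0 := by
        refine mul_ne_zero ?_ Complex.I_ne_zero
        exact_mod_cast sub_ne_zero.2 hk
      have : ∀ x : ℝ, ((k - n : ℤ) : ℂ) * x * Complex.I = (((k - n : ℤ) : ℂ) * Complex.I) * x := by
        intro x; ring
      simp only [this]
      rw [integral_exp_mul_complex hc]
      have : Complex.exp (((k - n : ℤ) : ℂ) * Complex.I * π) = Complex.exp (((k - n : ℤ) : ℂ) * Complex.I * (-π : ℝ)) := by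
        rw [Complex.exp_eq_exp_iff_exists_int]
        refine ⟨k - n, ?_⟩
        push_cast; ring
      rw [this]; simp
  rw [key.unique key2]
  have : (π : ℂ) ≠ 0 := by exact_mod_cast pi_ne_zero
  rw [Complex.real_smul]
  push_cast
  field_simp
  ring

/-- complex exponential form of a cosine series -/
lemma cos_to_exp (a : ℕ → ℝ) (ha0 : a 0 = 0) (x y : ℝ)
    (h : HasSum (fun n : ℕ => a n * Real.cos (n * x)) y) (ha : Summable a) :
    HasSum (fun m : ℤ => ((a m.natAbs / 2 : ℝ) : ℂ) * Complex.exp (m * x * Complex.I)) (y : ℂ) := by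
  have hs : ∀ t : ℝ, Summable (fun n : ℕ => ((a n / 2 : ℝ) : ℂ) * Complex.exp (n * t * Complex.I)) := by
    intro t
    refine Summable.of_norm ?_
    refine (summable_congr fun n => ?_).2 ((ha.abs).div_const 2)
    rw [norm_mul, show ((n : ℂ) * t * Complex.I) = ((n * t : ℝ) : ℂ) * Complex.I by push_cast; ring,
      Complex.norm_exp_ofReal_mul_I]
    simp
  have h1 := (hs x).hasSum
  have h2 := (hs (-x)).hasSum
  have h3 := h1.add h2
  have h4 : HasSum (fun n : ℕ => ((a n * Real.cos (n * x) : ℝ) : ℂ)) (y : ℂ) :=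
    Complex.hasSum_ofReal.2 h
  have e : ∀ n : ℕ, ((a n * Real.cos (n * x) : ℝ) : ℂ) =
      ((a n / 2 : ℝ) : ℂ) * Complex.exp (n * x * Complex.I) +
      ((a n / 2 : ℝ) : ℂ) * Complex.exp (n * (-x : ℝ) * Complex.I) := by
    intro n
    push_cast
    rw [Complex.cos]
    rw [show (n : ℂ) * -(x : ℂ) * Complex.I = -(n * x) * Complex.I by ring]
    ring
  simp only [e] at h4
  rw [h4.unique h3]
  have := HasSum.of_nat_of_neg (f := fun m : ℤ => ((a m.natAbs / 2 : ℝ) : ℂ) * Complex.exp (m * x * Complex.I))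
    (by simpa using h1) (by simpa using h2)
  simpa [ha0] using this

def shear : ℤ × ℤ ≃ ℤ × ℤ where
  toFun q := (q.2, q.1 - q.2)
  invFun q := (q.1 + q.2, q.1)
  left_inv q := by ext <;> simp
  right_inv q := by ext <;> simp

lemma sum_conv {R : Type*} [NormedRing R] [CompleteSpace R] (U V : ℤ → R) (S T : R)
    (hU : HasSum U S) (hV : HasSum V T)
    (hU' : Summable fun m => ‖U m‖) (hV' : Summable fun m => ‖V m‖) :
    (∀ k, Summable fun m => U m * V (k - m)) ∧
    HasSum (fun k => ∑' m, U m * V (k - m)) (S * T) := by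
  have h1 := hU.mul hV (summable_mul_of_summable_norm hU' hV')
  have h2 := shear.hasSum_iff.2 h1
  have h3 : ∀ k, Summable fun m => U m * V (k - m) := fun k => h2.summable.prod_factor k
  exact ⟨h3, h2.prod_fiberwise fun k => (h3 k).hasSum⟩

lemma norm_conv (U V : ℤ → ℝ) (hU : Summable U) (hV : Summable V) :
    Summable fun k => ‖∑' m, U m * V (k - m)‖ := by
  have := sum_conv (fun m => |U m|) (fun m => |V m|) _ _ hU.abs.hasSum hV.abs.hasSum
    (by simpa using hU.abs) (by simpa using hV.abs)
  refine Summable.of_nonneg_of_le (fun _ => norm_nonneg _) (fun k => ?_) this.2.summable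
  have h := this.1 k
  simp only [← abs_mul] at h ⊢
  exact norm_tsum_le_tsum_norm h

lemma natAbs_sum (c : ℕ → ℝ) (S : ℝ) (h0 : c 0 = 0) (h : HasSum c S) :
    HasSum (fun m : ℤ => c m.natAbs) (2 * S) := by
  have := HasSum.of_nat_of_neg (f := fun m : ℤ => c m.natAbs) (by simpa using h) (by simpa using h)
  simpa [h0, two_mul] using this

lemma bilinear_core (a b : ℕ → ℝ)
    (ha0 : a 0 = 0) (ha1 : a 1 = 0) (hb0 : b 0 = 0) (hb1 : b 1 = 0)
    (hXf : Summable (fun n : ℕ => ((n : ℝ) - 1) ^ 2 * a n ^ 2))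
    (hXg : Summable (fun n : ℕ => ((n : ℝ) - 1) ^ 2 * b n ^ 2))
    (ha : Summable a) (hb : Summable b) (F : ℤ → ℝ) (I : ℝ)
    (hF : ∀ k : ℤ, F k = ((k : ℝ) * ∑' m : ℤ, a m.natAbs / 2 * (b (k - m).natAbs / 2)) ^ 2)
    (hI : HasSum F I) :
    2 * I ≤ (π ^ 2 / 3 + 869 / 144) * (∑' n : ℕ, ((n : ℝ) - 1) ^ 2 * a n ^ 2) *
        (∑' n : ℕ, ((n : ℝ) - 1) ^ 2 * b n ^ 2) := by
  have hA := natAbs_sum _ _ (by simp [ha0]) hXf.hasSum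
  have hB := natAbs_sum _ _ (by simp [hb0]) hXg.hasSum
  have hA' := (natAbs_sum a _ ha0 ha.hasSum).summable.div_const 2
  have hB' := (natAbs_sum b _ hb0 hb.hasSum).summable.div_const 2
  have cv := (sum_conv _ _ _ _ hA'.hasSum hB'.hasSum hA'.norm hB'.norm).1
  have cq := sum_conv _ _ _ _ hA hB hA.summable.norm hB.summable.norm
  have fac : ∀ c : ℕ → ℝ, c 0 = 0 → c 1 = 0 → ∀ m : ℤ,
      c m.natAbs = wgt m * (((m.natAbs : ℝ) - 1) * c m.natAbs) := by
    intro c h0 h1 m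
    unfold wgt
    split_ifs with h
    · have h2 : (2 : ℝ) ≤ |(m : ℝ)| := by exact_mod_cast h
      have h3 : (m.natAbs : ℝ) = |(m : ℝ)| := by simp [Nat.cast_natAbs]
      rw [h3]
      have : |(m : ℝ)| - 1 ≠ 0 := by linarith
      field_simp
    · have : m.natAbs = 0 ∨ m.natAbs = 1 := by
        rw [Int.abs_eq_natAbs] at h
        omega
      rcases this with h | h <;> simp [h, h0, h1]
  have bound : ∀ k, F k ≤ 2 * (π ^ 2 / 3 + 869 / 144) * (1 / 16 *
      ∑' m : ℤ, ((m.natAbs : ℝ) - 1) ^ 2 * a m.natAbs ^ 2 *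
        ((((k - m).natAbs : ℝ) - 1) ^ 2 * b (k - m).natAbs ^ 2)) := by
    intro k
    rw [hF, ← tsum_mul_left]
    have e : ∀ m : ℤ, (k : ℝ) * (a m.natAbs / 2 * (b (k - m).natAbs / 2)) =
        ((k : ℝ) * wgt m * wgt (k - m)) * (1 / 4 * (((m.natAbs : ℝ) - 1) * a m.natAbs) *
          ((((k - m).natAbs : ℝ) - 1) * b (k - m).natAbs)) := by
      intro m
      have h1 := fac a ha0 ha1 m
      have h2 := fac b hb0 hb1 (k - m)
      calc _ = (k : ℝ) * ((wgt m * (((m.natAbs : ℝ) - 1) * a m.natAbs)) / 2 *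
            ((wgt (k - m) * ((((k - m).natAbs : ℝ) - 1) * b (k - m).natAbs)) / 2)) := by
              rw [← h1, ← h2]
        _ = _ := by ring
    have hs := (cv k).mul_left (k : ℝ)
    simp only [e] at hs ⊢
    refine cauchy _ _ _ _ hs (C_all k) ?_
    refine (hasSum_congr_aux fun m => ?_).2 ((cq.1 k).hasSum.mul_left (1 / 16))
    ring
  have := hasSum_le bound hI ((cq.2.mul_left (1 / 16)).mul_left (2 * (π ^ 2 / 3 + 869 / 144)))
  linarith

end Helpers

open Real in
/-- Lemma `bilinear-bound`: if `f = Σ_{n≥2} a n cos(nx)` and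
`g = Σ_{n≥2} b n cos(nx)` with `‖f‖_X² = Σ (n-1)²(a n)²` and `‖g‖_X² = Σ (n-1)²(b n)²`
finite, then `‖(fg)'‖_{L²} ≤ B ‖f‖_X ‖g‖_X` with `B = √(π²/3 + 869/144)`, where the `L²`
norm is normalized by `‖u‖² = (1/π) ∫_{-π}^{π} u²` (so `‖sin nx‖ = 1`). -/
theorem stmt3 (f g p : ℝ → ℝ) (a b : ℕ → ℝ)
    (ha0 : a 0 = 0) (ha1 : a 1 = 0) (hb0 : b 0 = 0) (hb1 : b 1 = 0)
    (hXf : Summable (fun n : ℕ => ((n : ℝ) - 1) ^ 2 * a n ^ 2))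
    (hXg : Summable (fun n : ℕ => ((n : ℝ) - 1) ^ 2 * b n ^ 2))
    (hf : ∀ x : ℝ, HasSum (fun n : ℕ => a n * Real.cos (n * x)) (f x))
    (hg : ∀ x : ℝ, HasSum (fun n : ℕ => b n * Real.cos (n * x)) (g x))
    (hp : ∀ x : ℝ, HasDerivAt (fun y => f y * g y) (p x) x) :
    Real.sqrt ((1 / π) * ∫ x in (-π)..π, p x ^ 2) ≤
      Real.sqrt (π ^ 2 / 3 + 869 / 144) *
        Real.sqrt (∑' n : ℕ, ((n : ℝ) - 1) ^ 2 * a n ^ 2) *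
        Real.sqrt (∑' n : ℕ, ((n : ℝ) - 1) ^ 2 * b n ^ 2) := by
  have ha : Summable a := by simpa using (hf 0).summable
  have hb : Summable b := by simpa using (hg 0).summable
  by_cases hpsq : IntervalIntegrable (fun x => p x ^ 2) MeasureTheory.volume (-π) π
  swap
  · rw [intervalIntegral.integral_undef hpsq]
    simp only [mul_zero, Real.sqrt_zero]
    positivity
  have hππ : -π < π := neg_lt_self pi_pos
  have hpd : p = deriv (fun y => f y * g y) := by
    funext x; exact (hp x).deriv.symm
  have hpm : Measurable p := by rw [hpd]; exact measurable_deriv _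
  have hL2r : MeasureTheory.MemLp p 2 (MeasureTheory.volume.restrict (Set.Ioc (-π) π)) := by
    rw [MeasureTheory.memLp_two_iff_integrable_sq hpm.aestronglyMeasurable]
    exact (intervalIntegrable_iff_integrableOn_Ioc_of_le hππ.le).1 hpsq
  have hL2 : MeasureTheory.MemLp (fun x => (p x : ℂ)) 2
      (MeasureTheory.volume.restrict (Set.Ioc (-π) π)) := hL2r.ofReal
  have hpi : IntervalIntegrable (fun x => (p x : ℂ)) MeasureTheory.volume (-π) π :=
    (intervalIntegrable_iff_integrableOn_Ioc_of_le hππ.le).2 (hL2.integrable (by norm_num))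
  have hA' := (natAbs_sum a _ ha0 ha.hasSum).summable.div_const 2
  have hB' := (natAbs_sum b _ hb0 hb.hasSum).summable.div_const 2
  set H : ℤ → ℝ := fun k => ∑' m : ℤ, a m.natAbs / 2 * (b (k - m).natAbs / 2) with hH
  have hser : ∀ x : ℝ, HasSum (fun k : ℤ => (H k : ℂ) * Complex.exp (k * x * Complex.I))
      ((f x * g x : ℝ) : ℂ) := by
    intro x
    have h1 := cos_to_exp a ha0 x _ (hf x) ha
    have h2 := cos_to_exp b hb0 x _ (hg x) hb
    have h3 := (sum_conv _ _ _ _ h1 h2 h1.summable.norm h2.summable.norm).2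
    rw [Complex.ofReal_mul]
    refine (hasSum_congr_aux fun k => ?_).2 h3
    rw [hH, Complex.ofReal_tsum, ← tsum_mul_right]
    refine tsum_congr fun m => ?_
    have : Complex.exp (k * x * Complex.I) = Complex.exp (m * x * Complex.I) *
        Complex.exp ((k - m : ℤ) * x * Complex.I) := by
      rw [← Complex.exp_add]; congr 1; push_cast; ring
    rw [this]; push_cast; ring
  have hco := coeff_series (fun k => (H k : ℂ))
    (by simpa using norm_conv _ _ hA' hB') (fun x => ((f x * g x : ℝ) : ℂ)) hser
  have hder : ∀ x : ℝ, HasDerivAt (fun y => ((f y * g y : ℝ) : ℂ)) (p x : ℂ) x :=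
    fun x => (hp x).ofReal_comp
  have hper : ((f π * g π : ℝ) : ℂ) = ((f (-π) * g (-π) : ℝ) : ℂ) := by
    have h1 : f π = f (-π) := (hf π).unique (by simpa using hf (-π))
    have h2 : g π = g (-π) := (hg π).unique (by simpa using hg (-π))
    rw [h1, h2]
  have hcp : ∀ k : ℤ, ‖fourierCoeffOn hππ (fun x => (p x : ℂ)) k‖ ^ 2 = ((k : ℝ) * H k) ^ 2 := by
    intro k
    by_cases hk : k = 0
    · subst hk
      rw [fourierCoeffOn_eq_integral]
      simp only [neg_zero, fourier_zero, one_smul]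
      rw [intervalIntegral.integral_eq_sub_of_hasDerivAt (fun x _ => hder x) hpi, hper]
      simp
    · have := fourierCoeffOn_of_hasDerivAt hππ hk (fun x _ => hder x) hpi
      rw [hco k, hper] at this
      have hπ : (π : ℂ) ≠ 0 := by exact_mod_cast pi_ne_zero
      have hkC : (k : ℂ) ≠ 0 := by exact_mod_cast hk
      have e : fourierCoeffOn hππ (fun x => (p x : ℂ)) k = Complex.I * ((k * H k : ℝ) : ℂ) := by
        push_cast
        rw [this]
        push_cast
        field_simp
        ring
      rw [e, norm_mul, Complex.norm_I, one_mul, Complex.norm_real, Real.norm_eq_abs, sq_abs]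
  have pars := hasSum_sq_fourierCoeffOn hππ hL2
  have fin := bilinear_core a b ha0 ha1 hb0 hb1 hXf hXg ha hb _ _ hcp pars
  rw [← Real.sqrt_mul (by positivity), ← Real.sqrt_mul (mul_nonneg (by positivity) (tsum_nonneg fun _ => by positivity))]
  refine Real.sqrt_le_sqrt (le_trans (le_of_eq ?_) fin)
  simp only [Complex.norm_real, Real.norm_eq_abs, sq_abs, smul_eq_mul]
  have := pi_ne_zero
  field_simp
  ring
end
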